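/- arXiv:0801.0449 — 5 statements merged into one kernel-verified Lean document; each statement's English description precedes it below -/
import Mathlib

section
/- Let k be a field, K a field extension of k, Γ₀ a linearly ordered commutative group with zero, and ν : K → Γ₀ a valuation that is trivial on k (i.e., ν(c) = 1 for every nonzero c ∈ k). Then for every k-subspace W of K (viewing K as a k-vector space) of finite dimension m, the image ν(W ∖ {0}) ⊆ Γ₀ has at most m elements. -/
/-- Nonzero elements with pairwise distinct values are linearly independent over a subfield on
which the valuation is trivial. -/
theorem Valuation.linearIndependent_of_injective
    {k K Γ₀ ι : Type*} [Field k] [Field K] [Algebra k K] [LinearOrderedCommGroupWithZero Γ₀]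
    (ν : Valuation K Γ₀) (htriv : ∀ c : k, c ≠ 0 → ν (algebraMap k K c) = 1)
    {x : ι → K} (hx : ∀ i, x i ≠ 0) (hinj : Function.Injective fun i => ν (x i)) :
    LinearIndependent k x := by
  classical
  have hsmul : ∀ (c : k) (y : K), c ≠ 0 → ν (c • y) = ν y := fun c y hc => by
    rw [Algebra.smul_def, map_mul, htriv c hc, one_mul]
  rw [linearIndependent_iff']
  intro s g hsum
  by_contra! h
  obtain ⟨i, his, hi⟩ := h
  obtain ⟨j, hj, hmax⟩ := (s.filter (g · ≠ 0)).exists_max_image (fun i => ν (x i))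
    ⟨i, by simp [his, hi]⟩
  obtain ⟨hjs, hgj⟩ := Finset.mem_filter.mp hj
  have hpos : ν (x j) ≠ 0 := ν.ne_zero_iff.mpr (hx j)
  have hval : ν (∑ i ∈ s, g i • x i) = ν (g j • x j) := by
    refine ν.map_sum_eq_of_lt hjs fun l hl => ?_
    obtain ⟨hls, hlj⟩ := Finset.mem_sdiff.mp hl
    rw [Finset.mem_singleton] at hlj
    rw [hsmul _ _ hgj]
    by_cases hgl : g l = 0
    · simpa [hgl] using zero_lt_iff.mpr hpos
    · rw [hsmul _ _ hgl]
      exact (hmax l (Finset.mem_filter.mpr ⟨hls, hgl⟩)).lt_of_ne (hinj.ne hlj)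
  rw [hsum, map_zero, hsmul _ _ hgj] at hval
  exact hpos hval.symm

/-- Let `k` be a field, `K` a field extension of `k`, `Γ₀` a linearly ordered
commutative group with zero, and `ν : K → Γ₀` a valuation that is trivial on `k` (i.e.
`ν c = 1` for every nonzero `c ∈ k`).  Then for every `k`-subspace `W` of `K` of finite
dimension `m`, the image `ν '' (W \ {0}) ⊆ Γ₀` has at most `m` elements. -/
theorem value_image_card_le_finrank
    {k K : Type*} [Field k] [Field K] [Algebra k K]
    {Γ₀ : Type*} [LinearOrderedCommGroupWithZero Γ₀]
    (ν : Valuation K Γ₀)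
    (htriv : ∀ c : k, c ≠ 0 → ν (algebraMap k K c) = 1)
    (W : Subspace k K) [FiniteDimensional k W]
    (m : ℕ) (hm : Module.finrank k W = m) :
    (ν '' ((W : Set K) \ {0})).Finite ∧ (ν '' ((W : Set K) \ {0})).ncard ≤ m := by
  choose x hx using fun γ : ν '' ((W : Set K) \ {0}) => γ.2
  have hli : LinearIndependent k fun γ => (⟨x γ, (hx γ).1.1⟩ : W) := by
    refine LinearIndependent.of_comp W.subtype ?_
    refine ν.linearIndependent_of_injective htriv (fun γ => (hx γ).1.2) fun γ δ h => ?_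
    exact Subtype.ext ((hx γ).2.symm.trans (h.trans (hx δ).2))
  have : Finite (ν '' ((W : Set K) \ {0})) := hli.finite
  have := Fintype.ofFinite (ν '' ((W : Set K) \ {0}))
  refine ⟨Set.toFinite _, ?_⟩
  rw [← hm, ← Nat.card_coe_set_eq, Nat.card_eq_fintype_card]
  exact hli.fintype_card_le_finrank
end

section
/- Let k be a field, n a positive integer, A_n = k[x₁,…,xₙ], m_n = (x₁,…,xₙ), and K = k(x₁,…,xₙ). Let ν be a real-valued (rank one) valuation on K dominating the localization (A_n)_{m_n}, and let s₀ ∈ ℝ be such that s₀ = ν(g) for some nonzero g ∈ m_n and s₀ ≤ ν(f) for every nonzero f ∈ m_n. Then for every natural number d, the set {ν(f) : f ∈ m_n, f ≠ 0} ∩ [0, (d+1)s₀) has fewer than (n+d choose n) elements. -/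
/-- The exponents of total degree at most `d` in `n` variables. -/
noncomputable def exponentsDegreeLE (n d : ℕ) : Finset (Fin n →₀ ℕ) :=
  ((Finset.univ : Finset (Fin (n + 1))).finsuppAntidiag d).image Finsupp.tail

theorem mem_exponentsDegreeLE {n d : ℕ} {a : Fin n →₀ ℕ} (ha : a.degree ≤ d) :
    a ∈ exponentsDegreeLE n d := by
  refine Finset.mem_image.2 ⟨Finsupp.cons (d - a.degree) a, ?_, Finsupp.tail_cons _ _⟩
  rw [Finset.mem_finsuppAntidiag]
  refine ⟨?_, Finset.subset_univ _⟩
  rw [Fin.sum_univ_succ]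
  simp only [Finsupp.cons_zero, Finsupp.cons_succ]
  rw [← Finsupp.degree_eq_sum]
  omega

theorem card_exponentsDegreeLE_le (n d : ℕ) :
    (exponentsDegreeLE n d).card ≤ (n + d).choose n := by
  refine Finset.card_image_le.trans (le_of_eq ?_)
  rw [Finset.card_finsuppAntidiag_nat_eq_choose, Finset.card_univ, Fintype.card_fin,
    show n + 1 + d - 1 = n + d by omega, Nat.choose_symm_add]

/-- Elements of a `k`-algebra with pairwise distinct finite values are linearly independent over
`k`, for every valuation that is trivial on `k`. -/
theorem AddValuation.linearIndependent_of_injective {k R Γ ι : Type*} [Field k] [CommRing R]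
    [Algebra k R] [LinearOrderedAddCommMonoidWithTop Γ] (v : AddValuation R Γ)
    (hv : ∀ c : k, c ≠ 0 → v (algebraMap k R c) = 0) (p : ι → R) (hp : ∀ i, v (p i) ≠ ⊤)
    (hinj : Function.Injective fun i => v (p i)) : LinearIndependent k p := by
  classical
  have hsmul : ∀ c : k, c ≠ 0 → ∀ i, v (c • p i) = v (p i) := fun c hc i => by
    rw [Algebra.smul_def, v.map_mul, hv c hc, zero_add]
  rw [linearIndependent_iff']
  intro s g hsum i hi
  by_contra hgi
  obtain ⟨j, hj, hmin⟩ := (s.filter fun i => g i ≠ 0).exists_min_image (fun i => v (p i))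
    ⟨i, Finset.mem_filter.2 ⟨hi, hgi⟩⟩
  obtain ⟨hjs, hgj⟩ := Finset.mem_filter.1 hj
  have hlt : v (p j) < v (∑ i ∈ s.erase j, g i • p i) := by
    refine v.map_lt_sum (hp j) fun i hi => ?_
    obtain ⟨hij, his⟩ := Finset.mem_erase.1 hi
    by_cases hg : g i = 0
    · rw [hg, zero_smul, v.map_zero]
      exact lt_top_iff_ne_top.2 (hp j)
    · rw [hsmul _ hg]
      exact lt_of_le_of_ne (hmin i (Finset.mem_filter.2 ⟨his, hg⟩)) fun h => hij (hinj h).symm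
  rw [← Finset.add_sum_erase s _ hjs] at hsum
  rw [← neg_eq_of_add_eq_zero_right hsum, v.map_neg, hsmul _ hgj] at hlt
  exact lt_irrefl _ hlt

/-- The monomials of degree greater than `d` do not affect values below `(d + 1) s₀`. -/
theorem AddValuation.exists_mem_restrictSupport_of_lt {k : Type*} [Field k] {n : ℕ}
    (v : AddValuation (MvPolynomial (Fin n) k) (WithTop ℝ)) (s₀ : ℝ) (hs₀ : 0 ≤ s₀)
    (hC : ∀ c : k, 0 ≤ v (MvPolynomial.C c)) (hX : ∀ i, (s₀ : WithTop ℝ) ≤ v (MvPolynomial.X i))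
    (d : ℕ) (f : MvPolynomial (Fin n) k) (hf : v f < (((d + 1 : ℝ) * s₀ : ℝ) : WithTop ℝ)) :
    ∃ g ∈ MvPolynomial.restrictSupport k (exponentsDegreeLE n d : Set (Fin n →₀ ℕ)),
      v g = v f := by
  classical
  have hmon : ∀ a : Fin n →₀ ℕ, d < a.degree → ∀ c : k,
      (((d + 1 : ℝ) * s₀ : ℝ) : WithTop ℝ) ≤ v (MvPolynomial.monomial a c) := by
    intro a ha c
    have hprod : ∀ t : Finset (Fin n), (((∑ i ∈ t, a i : ℕ) * s₀ : ℝ) : WithTop ℝ) ≤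
        v (∏ i ∈ t, (MvPolynomial.X i : MvPolynomial (Fin n) k) ^ a i) := by
      intro t
      induction t using Finset.induction_on with
      | empty => simp
      | insert i t hi ih =>
        rw [Finset.sum_insert hi, Finset.prod_insert hi, v.map_mul, v.map_pow, Nat.cast_add,
          add_mul, WithTop.coe_add, ← nsmul_eq_mul, WithTop.coe_nsmul]
        exact add_le_add (nsmul_le_nsmul_right (hX i) _) ih
    rw [MvPolynomial.monomial_eq, v.map_mul,
      Finsupp.prod_fintype _ _ (fun _ => pow_zero _)]
    refine le_trans ?_ (le_add_of_nonneg_left (hC c))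
    refine le_trans (WithTop.coe_le_coe.2 ?_) (hprod Finset.univ)
    rw [← Finsupp.degree_eq_sum]
    exact mul_le_mul_of_nonneg_right (by exact_mod_cast ha) hs₀
  set g := ∑ a ∈ f.support with a.degree ≤ d, MvPolynomial.monomial a (f.coeff a) with hg
  refine ⟨g, ?_, ?_⟩
  · refine Submodule.sum_mem _ fun a ha => ?_
    exact (MvPolynomial.monomial_mem_restrictSupport k).2
      (Or.inl (mem_exponentsDegreeLE (Finset.mem_filter.1 ha).2))
  · have hsub : g - f =
        -∑ a ∈ f.support with ¬ a.degree ≤ d, MvPolynomial.monomial a (f.coeff a) := by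
      conv_lhs => rw [f.as_sum, ← Finset.sum_filter_add_sum_filter_not f.support
        (fun a => a.degree ≤ d)]
      rw [hg]
      ring
    refine v.map_eq_of_lt_sub (hf.trans_le ?_)
    rw [hsub, v.map_neg]
    exact v.map_le_sum fun a ha => hmon a (not_le.1 (Finset.mem_filter.1 ha).2) _

/-- **Lemma 2 of the paper, rank one case.** Let `k` be a field, `n` a positive
integer, `Aₙ = k[x₁,…,xₙ]`, `mₙ = (x₁,…,xₙ)`, and `K = k(x₁,…,xₙ)`.  Let `ν` be a real-valued
(rank one) valuation on `K` dominating `(Aₙ)_{mₙ}`, and let `s₀ ∈ ℝ` be such that `s₀ = ν g` for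
some nonzero `g ∈ mₙ` and `s₀ ≤ ν f` for every nonzero `f ∈ mₙ`.  Then for every natural number
`d`, the set `{ν f : f ∈ mₙ, f ≠ 0} ∩ [0, (d+1)s₀)` has fewer than `(n+d).choose n` elements. -/
theorem card_values_lt_choose_polynomial_ring
    {k : Type*} [Field k] (n : ℕ) (hn : 0 < n)
    (ν : FractionRing (MvPolynomial (Fin n) k) → ℝ)
    (hmul : ∀ x y : FractionRing (MvPolynomial (Fin n) k),
      x ≠ 0 → y ≠ 0 → ν (x * y) = ν x + ν y)
    (hadd : ∀ x y : FractionRing (MvPolynomial (Fin n) k),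
      x ≠ 0 → y ≠ 0 → x + y ≠ 0 → min (ν x) (ν y) ≤ ν (x + y))
    (hdom : ∀ f : MvPolynomial (Fin n) k, f ≠ 0 →
      0 ≤ ν (algebraMap (MvPolynomial (Fin n) k) (FractionRing (MvPolynomial (Fin n) k)) f) ∧
      (0 < ν (algebraMap (MvPolynomial (Fin n) k) (FractionRing (MvPolynomial (Fin n) k)) f) ↔
        f ∈ Ideal.span (Set.range (MvPolynomial.X : Fin n → MvPolynomial (Fin n) k))))
    (s₀ : ℝ)
    (hg : ∃ g ∈ Ideal.span (Set.range (MvPolynomial.X : Fin n → MvPolynomial (Fin n) k)),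
      g ≠ 0 ∧
      ν (algebraMap (MvPolynomial (Fin n) k) (FractionRing (MvPolynomial (Fin n) k)) g) = s₀)
    (hmin : ∀ f ∈ Ideal.span (Set.range (MvPolynomial.X : Fin n → MvPolynomial (Fin n) k)),
      f ≠ 0 →
      s₀ ≤ ν (algebraMap (MvPolynomial (Fin n) k) (FractionRing (MvPolynomial (Fin n) k)) f))
    (d : ℕ) :
    ({x : ℝ | ∃ f ∈ Ideal.span (Set.range (MvPolynomial.X : Fin n → MvPolynomial (Fin n) k)),
        f ≠ 0 ∧
        ν (algebraMap (MvPolynomial (Fin n) k) (FractionRing (MvPolynomial (Fin n) k)) f) = x}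
      ∩ Set.Ico 0 ((d + 1 : ℝ) * s₀)).Finite ∧
    ({x : ℝ | ∃ f ∈ Ideal.span (Set.range (MvPolynomial.X : Fin n → MvPolynomial (Fin n) k)),
        f ≠ 0 ∧
        ν (algebraMap (MvPolynomial (Fin n) k) (FractionRing (MvPolynomial (Fin n) k)) f) = x}
      ∩ Set.Ico 0 ((d + 1 : ℝ) * s₀)).ncard < (n + d).choose n := by
  classical
  set m : Ideal (MvPolynomial (Fin n) k) := Ideal.span (Set.range MvPolynomial.X)
  have hφ : ∀ f : MvPolynomial (Fin n) k, f ≠ 0 → algebraMap _ (FractionRing (MvPolynomial (Fin n) k)) f ≠ 0 :=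
    fun f hf =>
    (map_ne_zero_iff _ (IsFractionRing.injective _ _)).2 hf
  have hν1 : ν 1 = 0 := by
    have h := hmul 1 1 one_ne_zero one_ne_zero
    rw [mul_one] at h
    linarith
  let v : AddValuation (MvPolynomial (Fin n) k) (WithTop ℝ) := AddValuation.of
    (fun f => if f = 0 then ⊤ else
      ((ν (algebraMap _ (FractionRing (MvPolynomial (Fin n) k)) f) : ℝ) : WithTop ℝ))
    (by simp) (by simp [hν1])
    (by
      intro x y
      by_cases hx : x = 0
      · simp [hx]
      by_cases hy : y = 0
      · simp [hy]
      by_cases hxy : x + y = 0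
      · simp [hxy]
      simp only [hx, hy, hxy, if_false]
      rw [← WithTop.coe_min, WithTop.coe_le_coe, map_add]
      exact hadd _ _ (hφ x hx) (hφ y hy) (by rw [← map_add]; exact hφ _ hxy))
    (by
      intro x y
      by_cases hx : x = 0
      · simp [hx]
      by_cases hy : y = 0
      · simp [hy]
      simp only [hx, hy, mul_eq_zero, or_self, if_false]
      rw [← WithTop.coe_add, map_mul, hmul _ _ (hφ x hx) (hφ y hy)])
  have hv : ∀ f : MvPolynomial (Fin n) k, f ≠ 0 → v f =
      ((ν (algebraMap _ (FractionRing (MvPolynomial (Fin n) k)) f) : ℝ) : WithTop ℝ) := fun f hf =>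
    if_neg hf
  have hs₀ : 0 < s₀ := by
    obtain ⟨g, hgm, hg0, rfl⟩ := hg
    exact (hdom g hg0).2.2 hgm
  have hm1 : (1 : MvPolynomial (Fin n) k) ∉ m := fun h => by
    have := (hdom 1 one_ne_zero).2.2 h
    rw [map_one, hν1] at this
    exact lt_irrefl _ this
  have hC : ∀ c : k, c ≠ 0 → v (algebraMap k (MvPolynomial (Fin n) k) c) = 0 := by
    intro c hc
    have hc0 : algebraMap k (MvPolynomial (Fin n) k) c ≠ 0 :=
      (map_ne_zero_iff _ (algebraMap k (MvPolynomial (Fin n) k)).injective).2 hc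
    have hcm : algebraMap k (MvPolynomial (Fin n) k) c ∉ m := fun h => hm1 <| by
      have := m.mul_mem_left (algebraMap k (MvPolynomial (Fin n) k) c⁻¹) h
      rwa [← map_mul, inv_mul_cancel₀ hc, map_one] at this
    rw [hv _ hc0, WithTop.coe_eq_zero]
    exact le_antisymm (not_lt.1 fun h => hcm ((hdom _ hc0).2.1 h)) (hdom _ hc0).1
  have hX : ∀ i, (s₀ : WithTop ℝ) ≤ v (MvPolynomial.X i) := fun i => by
    rw [hv _ (MvPolynomial.X_ne_zero i), WithTop.coe_le_coe]
    exact hmin _ (Ideal.subset_span ⟨i, rfl⟩) (MvPolynomial.X_ne_zero i)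
  set S : Set ℝ :=
    {x : ℝ | ∃ f ∈ m, f ≠ 0 ∧ ν (algebraMap _ (FractionRing (MvPolynomial (Fin n) k)) f) = x} ∩
    Set.Ico 0 ((d + 1 : ℝ) * s₀)
  have h0S : (0 : ℝ) ∉ S := by
    rintro ⟨⟨f, hfm, hf0, hf⟩, -⟩
    exact ((hdom f hf0).2.2 hfm).ne' hf
  let V := MvPolynomial.restrictSupport k (exponentsDegreeLE n d : Set (Fin n →₀ ℕ))
  have hrep : ∀ x : (insert 0 S : Set ℝ),
      ∃ g : V, v (g : MvPolynomial (Fin n) k) = ((x : ℝ) : WithTop ℝ) := by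
    have key : ∀ (x : ℝ) (f : MvPolynomial (Fin n) k), x < (d + 1 : ℝ) * s₀ → v f = (x : WithTop ℝ) →
        ∃ g : V, v (g : MvPolynomial (Fin n) k) = (x : WithTop ℝ) := by
      intro x f hx hf
      obtain ⟨g, hgV, hg⟩ := v.exists_mem_restrictSupport_of_lt s₀ hs₀.le (fun c => by
        by_cases hc : c = 0
        · simp [hc]
        · exact (hC c hc).ge) hX d f (by rw [hf]; exact WithTop.coe_lt_coe.2 hx)
      exact ⟨⟨g, hgV⟩, hg.trans hf⟩
    rintro ⟨x, rfl | ⟨⟨f, -, hf0, rfl⟩, -, hx⟩⟩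
    · exact key 0 1 (by positivity) (by rw [v.map_one, WithTop.coe_zero])
    · exact key _ f hx (hv f hf0)
  choose p hp using hrep
  have hlin : LinearIndependent k p := by
    refine LinearIndependent.of_comp V.subtype (v.linearIndependent_of_injective hC _ ?_ ?_)
    · intro x
      simp [hp]
    · intro x y hxy
      simpa [hp, Subtype.ext_iff] using hxy
  let b := MvPolynomial.basisRestrictSupport k (exponentsDegreeLE n d : Set (Fin n →₀ ℕ))
  have : Module.Finite k V := Module.Finite.of_basis b
  have hfin : Finite (insert 0 S : Set ℝ) := hlin.finite
  have hSfin : S.Finite := (Set.toFinite (insert 0 S)).subset (Set.subset_insert _ _)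
  refine ⟨hSfin, ?_⟩
  rw [← Nat.succ_le_iff, Nat.succ_eq_add_one, ← Set.ncard_insert_of_notMem h0S hSfin]
  have := Fintype.ofFinite (insert 0 S : Set ℝ)
  calc (insert 0 S).ncard = Fintype.card (insert 0 S : Set ℝ) := by
        rw [← Nat.card_coe_set_eq, Nat.card_eq_fintype_card]
    _ ≤ Module.finrank k V := hlin.fintype_card_le_finrank
    _ = (exponentsDegreeLE n d).card := by rw [Module.finrank_eq_card_basis b]; simp
    _ ≤ (n + d).choose n := card_exponentsDegreeLE_le n d
end

section
/- Let A be a noetherian local domain containing a field (equicharacteristic), with maximal ideal m_A and fraction field K. Let ν be a real-valued (rank one) valuation on K dominating A. Let s₀ = min{ν(f) : f ∈ m_A, f ≠ 0} (assume this minimum exists, i.e., s₀ = ν(g) for some nonzero g ∈ m_A and s₀ ≤ ν(f) for all nonzero f ∈ m_A), and let n = dim_{A/m_A}(m_A/m_A²) be the embedding dimension of A. Then for every natural number d, the set {ν(f) : f ∈ m_A, f ≠ 0} ∩ [0, (d+1)s₀) has fewer than (n+d choose n) elements. -/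
open IsLocalRing

/-- A module generated by finitely many elements, each killed by a maximal ideal, has length at
most the number of generators. -/
theorem Module.length_span_range_le_card_of_smul_eq_zero {R M ι : Type*} [CommRing R]
    [AddCommGroup M] [Module R M] [Fintype ι] (m : Ideal R) [hm : m.IsMaximal] (v : ι → M)
    (hv : ∀ a ∈ m, ∀ i, a • v i = 0) :
    Module.length R (Submodule.span R (Set.range v)) ≤ Fintype.card ι := by
  classical
  have : IsSimpleModule R (R ⧸ m) := isSimpleModule_iff_isCoatom.mpr hm.out
  let g : ι → (R ⧸ m) →ₗ[R] M := fun i ↦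
    Submodule.liftQ m (LinearMap.toSpanSingleton R M (v i)) fun a ha ↦ by simpa using hv a ha i
  let G : (ι → R ⧸ m) →ₗ[R] M := LinearMap.lsum R (fun _ : ι ↦ R ⧸ m) R g
  have hle : Submodule.span R (Set.range v) ≤ LinearMap.range G := by
    rw [Submodule.span_le]
    rintro _ ⟨i, rfl⟩
    refine ⟨Pi.single i (Submodule.Quotient.mk 1), ?_⟩
    simp only [G, LinearMap.lsum_piSingle]
    exact (Submodule.liftQ_apply _ _ _).trans (one_smul R _)
  calc Module.length R (Submodule.span R (Set.range v))
      ≤ Module.length R (LinearMap.range G) :=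
        Module.length_le_of_injective (Submodule.inclusion hle) (Submodule.inclusion_injective hle)
    _ ≤ Module.length R (ι → R ⧸ m) :=
        Module.length_le_of_surjective G.rangeRestrict G.surjective_rangeRestrict
    _ = Fintype.card ι := by simp [Module.length_pi_of_fintype]

/-- The `i`-th power of an ideal is generated by the degree `i` monomials in its generators. -/
theorem Ideal.span_range_pow_eq_span_sym_prod {R σ : Type*} [CommRing R] (x : σ → R) (i : ℕ) :
    Ideal.span (Set.range x) ^ i =
      Ideal.span (Set.range fun s : Sym σ i ↦ ((s : Multiset σ).map x).prod) := by
  induction i with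
  | zero =>
    rw [pow_zero, Ideal.one_eq_top, eq_comm, Ideal.eq_top_iff_one]
    exact Ideal.subset_span ⟨Sym.nil, by simp⟩
  | succ i ih =>
    rw [pow_succ', ih, Ideal.span_mul_span']
    congr 1
    ext y
    simp only [Set.mem_mul, Set.mem_range, exists_exists_eq_and]
    constructor
    · rintro ⟨a, s, rfl⟩
      refine ⟨a ::ₛ s, ?_⟩
      change (Multiset.map x (a ::ₘ (s : Multiset σ))).prod = _
      rw [Multiset.map_cons, Multiset.prod_cons]
    · rintro ⟨s, rfl⟩
      obtain ⟨a, t, rfl⟩ := s.exists_eq_cons_of_succ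
      refine ⟨a, t, ?_⟩
      change _ = (Multiset.map x (a ::ₘ (t : Multiset σ))).prod
      rw [Multiset.map_cons, Multiset.prod_cons]

/-- If a maximal ideal `m` is generated by `n` elements, then `R ⧸ m ^ (d + 1)` has length at most
`(n + d).choose n`. -/
theorem Ideal.length_quotient_pow_succ_le_choose {R σ : Type*} [CommRing R] [Fintype σ]
    (m : Ideal R) [hm : m.IsMaximal] (x : σ → R) (hx : Ideal.span (Set.range x) = m) (d : ℕ) :
    Module.length R (R ⧸ m ^ (d + 1)) ≤ (Fintype.card σ + d).choose (Fintype.card σ) := by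
  classical
  set n := Fintype.card σ
  rw [show (n + d).choose n = (n + 1).multichoose d by
    rw [Nat.multichoose_eq, show n + 1 + d - 1 = n + d by omega, Nat.choose_symm_add]]
  induction d with
  | zero =>
    have : IsSimpleModule R (R ⧸ m) := isSimpleModule_iff_isCoatom.mpr hm.out
    rw [zero_add, pow_one]
    simp [Module.length_eq_one]
  | succ d ih =>
    let S : Submodule R R := m ^ (d + 1 + 1)
    let T : Submodule R R := m ^ (d + 1)
    have hST : S ≤ T := Ideal.pow_le_pow_right (Nat.le_succ _)
    let N : Submodule R (R ⧸ S) := T.map S.mkQ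
    have hN : Module.length R N ≤ n.multichoose (d + 1) := by
      let w : Sym σ (d + 1) → R := fun s ↦ ((s : Multiset σ).map x).prod
      have hT : T = Submodule.span R (Set.range w) := by
        simp only [T]
        rw [← hx]
        exact Ideal.span_range_pow_eq_span_sym_prod x (d + 1)
      have hNs : N = Submodule.span R (Set.range (S.mkQ ∘ w)) := by
        rw [Set.range_comp, ← Submodule.map_span, ← hT]
      rw [hNs]
      refine (Module.length_span_range_le_card_of_smul_eq_zero m _ fun a ha s ↦ ?_).trans ?_
      · rw [Function.comp_apply, ← map_smul, Submodule.mkQ_apply, Submodule.Quotient.mk_eq_zero]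
        have hw : w s ∈ T := hT ▸ Submodule.subset_span ⟨s, rfl⟩
        have hS : S = m * T := pow_succ' m (d + 1)
        exact hS ▸ Ideal.mul_mem_mul ha hw
      · rw [Sym.card_sym_eq_multichoose]
    have hQ : Module.length R ((R ⧸ S) ⧸ N) = Module.length R (R ⧸ T) :=
      (Submodule.quotientQuotientEquivQuotient S T hST).length_eq
    calc Module.length R (R ⧸ S)
        = Module.length R N + Module.length R ((R ⧸ S) ⧸ N) :=
          Module.length_eq_add_of_exact N.subtype N.mkQ N.subtype_injective N.mkQ_surjective
            (LinearMap.exact_subtype_mkQ N)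
      _ ≤ n.multichoose (d + 1) + (n + 1).multichoose d := add_le_add hN (hQ ▸ ih)
      _ = (n + 1).multichoose (d + 1) := by rw [Nat.multichoose_succ_succ]; push_cast; rfl

/-- In a noetherian local ring of embedding dimension `n`, the quotient by the `(d + 1)`-st power
of the maximal ideal has length at most `(n + d).choose n`. -/
theorem IsLocalRing.length_quotient_maximalIdeal_pow_succ_le (A : Type*) [CommRing A]
    [IsNoetherianRing A] [IsLocalRing A] (d : ℕ) :
    Module.length A (A ⧸ maximalIdeal A ^ (d + 1)) ≤
      (Module.finrank (ResidueField A) (CotangentSpace A) + d).choose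
        (Module.finrank (ResidueField A) (CotangentSpace A)) := by
  have hfg := (maximalIdeal A).fg_of_isNoetherianRing
  have := (Submodule.FG.finite_generators hfg).fintype
  have h := Ideal.length_quotient_pow_succ_le_choose (maximalIdeal A)
    (Subtype.val : (maximalIdeal A).generators → A)
    (by rw [Subtype.range_coe]; exact Submodule.span_generators _) d
  rwa [← Nat.card_eq_fintype_card, Nat.card_coe_set_eq, Submodule.FG.generators_ncard hfg,
    spanFinrank_maximalIdeal_eq_finrank_cotangentSpace] at h

/-- A family of submodules indexed by a linear order gives a lower bound for the length of a module
as soon as it is strictly antitone on a finite set. -/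
theorem Module.card_le_length_add_one_of_strictAntiOn {R M α : Type*} [Ring R] [AddCommGroup M]
    [Module R M] [LinearOrder α] (I : α → Submodule R M) (T : Finset α)
    (hI : StrictAntiOn I T) : (T.card : ℕ∞) ≤ Module.length R M + 1 := by
  rcases hT : T.card with _ | k
  · simp
  let e := T.orderEmbOfFin hT
  let s : LTSeries (Submodule R M) :=
    { length := k
      toFun := fun i ↦ I (e i.rev)
      step := fun i ↦ hI (T.orderEmbOfFin_mem hT _) (T.orderEmbOfFin_mem hT _)
        (e.strictMono (Fin.rev_lt_rev.mpr i.castSucc_lt_succ)) }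
  have h := Order.LTSeries.length_le_krullDim s
  rw [← Module.coe_length] at h
  have h' : (k : ℕ∞) ≤ Module.length R M := by exact_mod_cast h
  push_cast
  gcongr

/-- A set all of whose finite subsets have fewer than `N` elements is finite and has fewer than `N`
elements. -/
theorem Set.finite_and_ncard_lt_of_forall_finset {α : Type*} {s : Set α} {N : ℕ}
    (h : ∀ T : Finset α, (T : Set α) ⊆ s → T.card < N) : s.Finite ∧ s.ncard < N := by
  have hs : s.Finite := by
    by_contra hs
    obtain ⟨T, hT, hc⟩ := Set.Infinite.exists_subset_card_eq hs N
    exact (h T hT).ne hc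
  refine ⟨hs, ?_⟩
  rw [Set.ncard_eq_toFinset_card s hs]
  exact h _ (by simp)

namespace FractionRingValuation

variable {A : Type*} [CommRing A]

/-- The elements of `A` of value at least `c`, for a function `ν` on the fraction field of `A` which
is additive on products, ultrametric on sums and nonnegative on `A`. -/
def valueIdeal (ν : FractionRing A → ℝ)
    (hmul : ∀ x y : FractionRing A, x ≠ 0 → y ≠ 0 → ν (x * y) = ν x + ν y)
    (hadd : ∀ x y : FractionRing A, x ≠ 0 → y ≠ 0 → x + y ≠ 0 → min (ν x) (ν y) ≤ ν (x + y))
    (hnonneg : ∀ a : A, a ≠ 0 → 0 ≤ ν (algebraMap A (FractionRing A) a)) (c : ℝ) : Ideal A where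
  carrier := {a | a ≠ 0 → c ≤ ν (algebraMap A (FractionRing A) a)}
  zero_mem' h := absurd rfl h
  add_mem' {a b} ha hb hab := by
    rcases eq_or_ne a 0 with rfl | ha0
    · rw [zero_add] at hab ⊢
      exact hb hab
    rcases eq_or_ne b 0 with rfl | hb0
    · rw [add_zero] at hab ⊢
      exact ha hab
    rw [map_add]
    refine (le_min (ha ha0) (hb hb0)).trans (hadd _ _ ?_ ?_ ?_)
    · simpa using ha0
    · simpa using hb0
    · rwa [← map_add, ne_eq, FaithfulSMul.algebraMap_eq_zero_iff]
  smul_mem' r a ha hra := by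
    rw [smul_eq_mul] at hra ⊢
    have hr0 := left_ne_zero_of_mul hra
    have ha0 := right_ne_zero_of_mul hra
    rw [map_mul, hmul _ _ (by simpa using hr0) (by simpa using ha0)]
    linarith [hnonneg r hr0, ha ha0]

variable {ν : FractionRing A → ℝ}
  {hmul : ∀ x y : FractionRing A, x ≠ 0 → y ≠ 0 → ν (x * y) = ν x + ν y}
  {hadd : ∀ x y : FractionRing A, x ≠ 0 → y ≠ 0 → x + y ≠ 0 → min (ν x) (ν y) ≤ ν (x + y)}
  {hnonneg : ∀ a : A, a ≠ 0 → 0 ≤ ν (algebraMap A (FractionRing A) a)}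

theorem mem_valueIdeal {c : ℝ} {a : A} : a ∈ valueIdeal ν hmul hadd hnonneg c ↔
    (a ≠ 0 → c ≤ ν (algebraMap A (FractionRing A) a)) := Iff.rfl

theorem valueIdeal_antitone : Antitone (valueIdeal ν hmul hadd hnonneg) :=
  fun _ _ h _ ha h0 ↦ h.trans (ha h0)

theorem mul_valueIdeal_le (b c : ℝ) :
    valueIdeal ν hmul hadd hnonneg b * valueIdeal ν hmul hadd hnonneg c ≤
      valueIdeal ν hmul hadd hnonneg (b + c) := by
  refine Ideal.mul_le.mpr fun x hx y hy hxy ↦ ?_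
  have hx0 := left_ne_zero_of_mul hxy
  have hy0 := right_ne_zero_of_mul hxy
  rw [map_mul, hmul _ _ (by simpa using hx0) (by simpa using hy0)]
  exact add_le_add (hx hx0) (hy hy0)

theorem pow_le_valueIdeal {J : Ideal A} {c : ℝ} (h : J ≤ valueIdeal ν hmul hadd hnonneg c)
    (k : ℕ) : J ^ k ≤ valueIdeal ν hmul hadd hnonneg (k * c) := by
  induction k with
  | zero => intro a _ ha; simpa using hnonneg a ha
  | succ k ih =>
    rw [pow_succ, Nat.cast_succ, add_one_mul]
    exact (Ideal.mul_mono ih h).trans (mul_valueIdeal_le _ _)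

/-- On a finite set of reals all of whose members below `b` are values of elements of `A`, the
value ideals give a strictly decreasing family of submodules of `A ⧸ J`, provided that `J` is
contained in the value ideal of level `b`. -/
theorem strictAntiOn_map_valueIdeal {J : Ideal A} {b : ℝ}
    (hJ : J ≤ valueIdeal ν hmul hadd hnonneg b) {T : Set ℝ} (hb : ∀ c ∈ T, c ≤ b)
    (hT : ∀ c ∈ T, c < b → ∃ f : A, f ≠ 0 ∧ ν (algebraMap A (FractionRing A) f) = c) :
    StrictAntiOn (fun c ↦ Submodule.map (Submodule.mkQ J)
      (valueIdeal ν hmul hadd hnonneg c)) T := by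
  intro c hc c' hc' hcc'
  refine lt_of_le_of_ne (Submodule.map_mono (valueIdeal_antitone hcc'.le)) fun heq ↦ ?_
  obtain ⟨f, hf0, hf⟩ := hT c hc (hcc'.trans_le (hb c' hc'))
  have hmem : Submodule.mkQ J f ∈ Submodule.map (Submodule.mkQ J)
      (valueIdeal ν hmul hadd hnonneg c) :=
    Submodule.mem_map_of_mem (mem_valueIdeal.mpr fun _ ↦ hf.ge)
  dsimp only at heq
  rw [← heq, ← Submodule.mem_comap, Submodule.comap_map_mkQ,
    sup_eq_right.mpr (hJ.trans (valueIdeal_antitone (hb c' hc')))] at hmem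
  exact absurd (hmem hf0) (by rw [hf]; exact not_le.mpr hcc')

end FractionRingValuation


/-- **Theorem 1 of the paper, rank one case.** Let `A` be an equicharacteristic
noetherian local domain (i.e. `A` contains a field) with maximal ideal `m_A` and fraction field
`K`.  Let `ν` be a real-valued (rank one) valuation on `K` dominating `A`,
`s₀ = min {ν f : f ∈ m_A, f ≠ 0}` (assumed to exist), and
`n = dim_{A/m_A} (m_A/m_A²)` the embedding dimension of `A`.  Then for every natural number `d`,
the set `{ν f : f ∈ m_A, f ≠ 0} ∩ [0, (d+1)s₀)` has fewer than `(n+d).choose n` elements. -/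
theorem card_values_lt_choose_local_domain
    {A : Type*} [CommRing A] [IsDomain A] [IsNoetherianRing A] [IsLocalRing A]
    (hequichar : ∃ k : Subring A, IsField k)
    (ν : FractionRing A → ℝ)
    (hmul : ∀ x y : FractionRing A, x ≠ 0 → y ≠ 0 → ν (x * y) = ν x + ν y)
    (hadd : ∀ x y : FractionRing A, x ≠ 0 → y ≠ 0 → x + y ≠ 0 → min (ν x) (ν y) ≤ ν (x + y))
    (hdom : ∀ a : A, a ≠ 0 →
      0 ≤ ν (algebraMap A (FractionRing A) a) ∧
      (0 < ν (algebraMap A (FractionRing A) a) ↔ a ∈ IsLocalRing.maximalIdeal A))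
    (s₀ : ℝ)
    (hg : ∃ g ∈ IsLocalRing.maximalIdeal A, g ≠ 0 ∧ ν (algebraMap A (FractionRing A) g) = s₀)
    (hmin : ∀ f ∈ IsLocalRing.maximalIdeal A, f ≠ 0 →
      s₀ ≤ ν (algebraMap A (FractionRing A) f))
    (n : ℕ)
    (hn : Module.finrank (IsLocalRing.ResidueField A) (IsLocalRing.maximalIdeal A).Cotangent = n)
    (d : ℕ) :
    ({x : ℝ | ∃ f ∈ IsLocalRing.maximalIdeal A, f ≠ 0 ∧
        ν (algebraMap A (FractionRing A) f) = x}
      ∩ Set.Ico 0 ((d + 1 : ℝ) * s₀)).Finite ∧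
    ({x : ℝ | ∃ f ∈ IsLocalRing.maximalIdeal A, f ≠ 0 ∧
        ν (algebraMap A (FractionRing A) f) = x}
      ∩ Set.Ico 0 ((d + 1 : ℝ) * s₀)).ncard < (n + d).choose n := by
  obtain ⟨g, hgm, hg0, hgs⟩ := hg
  have hs₀ : 0 < s₀ := hgs ▸ (hdom g hg0).2.mpr hgm
  have hnonneg := fun a ha ↦ (hdom a ha).1
  set b : ℝ := (d + 1 : ℝ) * s₀ with hb
  have hb0 : 0 < b := by positivity
  have hJ : maximalIdeal A ^ (d + 1) ≤
      FractionRingValuation.valueIdeal ν hmul hadd hnonneg b := by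
    have := FractionRingValuation.pow_le_valueIdeal (ν := ν) (hmul := hmul) (hadd := hadd)
      (hnonneg := hnonneg) (J := maximalIdeal A) (c := s₀) (fun f hf hf0 ↦ hmin f hf hf0) (d + 1)
    rwa [Nat.cast_succ] at this
  have hν1 : ν (algebraMap A (FractionRing A) 1) = 0 := by
    have := hmul 1 1 one_ne_zero one_ne_zero
    rw [mul_one] at this
    rw [map_one]
    linarith
  refine Set.finite_and_ncard_lt_of_forall_finset fun T hT ↦ ?_
  have hpos : ∀ c ∈ T, 0 < c := by
    intro c hc
    obtain ⟨⟨f, hfm, hf0, rfl⟩, -⟩ := hT hc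
    exact (hdom f hf0).2.mpr hfm
  have hlt : ∀ c ∈ T, c < b := fun c hc ↦ (hT hc).2.2
  have h0T : (0 : ℝ) ∉ T := fun h ↦ (hpos 0 h).false
  have hbT : b ∉ insert 0 T := by
    rw [Finset.mem_insert, not_or]
    exact ⟨hb0.ne', fun h ↦ (hlt b h).false⟩
  have hcard := Module.card_le_length_add_one_of_strictAntiOn _ (insert b (insert 0 T))
    (FractionRingValuation.strictAntiOn_map_valueIdeal hJ
      (by
        intro c hc
        simp only [Finset.coe_insert, Set.mem_insert_iff, Finset.mem_coe] at hc
        rcases hc with rfl | rfl | hc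
        exacts [le_rfl, hb0.le, (hlt c hc).le])
      (by
        intro c hc hcb
        simp only [Finset.coe_insert, Set.mem_insert_iff, Finset.mem_coe] at hc
        rcases hc with rfl | rfl | hc
        · exact absurd hcb (lt_irrefl _)
        · exact ⟨1, one_ne_zero, hν1⟩
        · obtain ⟨⟨f, -, hf0, hf⟩, -⟩ := hT hc
          exact ⟨f, hf0, hf⟩))
  rw [Finset.card_insert_of_notMem hbT, Finset.card_insert_of_notMem h0T] at hcard
  have hlen := IsLocalRing.length_quotient_maximalIdeal_pow_succ_le A d
  rw [show Module.finrank (ResidueField A) (CotangentSpace A) = n from hn] at hlen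
  have h : ((T.card + 1 + 1 : ℕ) : ℕ∞) ≤ (((n + d).choose n + 1 : ℕ) : ℕ∞) := by
    refine hcard.trans ?_
    push_cast
    gcongr
  have := Nat.cast_le.mp h
  omega
end

section
/- There exists an additive subsemigroup U of ℚ consisting of positive elements, with U ∩ [0, r) finite for every rational r (so that U is well-ordered of ordinal type ω), such that for every field k, every positive integer n, and every real-valued (rank one) valuation ν on k(x₁,…,xₙ) dominating the localization of k[x₁,…,xₙ] at the maximal ideal m_n = (x₁,…,xₙ), the set {ν(f) : f ∈ m_n, f ≠ 0} is not equal to the image of U in ℝ. -/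
/-- The number of elements with distinct values below `γ` is at most the codimension of a subspace
of elements with values at least `γ`. -/
lemma card_le_finrank_of_strictMono_addValuation {k R Γ W : Type*} [Field k] [CommRing R]
    [Algebra k R] [LinearOrderedAddCommMonoidWithTop Γ]
    [AddCommGroup W] [Module k W] [Module.Finite k W]
    (v : AddValuation R Γ) (hv : ∀ c : k, c ≠ 0 → v (algebraMap k R c) = 0)
    (L : R →ₗ[k] W) {N : ℕ} (f : Fin N → R) (hf : StrictMono (fun j => v (f j)))
    (γ : Γ) (hγ : ∀ j, v (f j) < γ) (hL : ∀ g, L g = 0 → γ ≤ v g) :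
    N ≤ Module.finrank k W := by
  have hsmul : ∀ (c : k) (x : R), c ≠ 0 → v (c • x) = v x := fun c x hc => by
    rw [Algebra.smul_def, v.map_mul, hv c hc, zero_add]
  have hli : LinearIndependent k (fun j => L (f j)) := by
    rw [Fintype.linearIndependent_iff]
    intro c hc
    by_contra! hne
    obtain ⟨i, hi, hmin⟩ := exists_minimal_of_wellFoundedLT (fun j => c j ≠ 0) hne
    have hLg : L (∑ j, c j • f j) = 0 := by simpa using hc
    have hg := hL _ hLg
    have hlt : v (f i) < v (∑ j ∈ Finset.univ.erase i, c j • f j) := by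
      refine v.map_lt_sum ((hγ i).trans_le le_top).ne fun j hj => ?_
      rcases eq_or_ne (c j) 0 with h0 | h0
      · simpa [h0] using (hγ i).trans_le le_top
      · rw [hsmul _ _ h0]
        refine hf (lt_of_not_ge fun hle => Finset.ne_of_mem_erase hj ?_)
        exact le_antisymm hle (hmin h0 hle)
    have heq : c i • f i = ∑ j, c j • f j - ∑ j ∈ Finset.univ.erase i, c j • f j := by
      rw [← Finset.add_sum_erase _ _ (Finset.mem_univ i), add_sub_cancel_right]
    have h := v.map_sub (∑ j, c j • f j) (∑ j ∈ Finset.univ.erase i, c j • f j)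
    rw [← heq, hsmul _ _ hi] at h
    exact absurd h (not_le.2 (lt_min ((hγ i).trans_le hg) hlt))
  simpa using hli.fintype_card_le_finrank

/-- A polynomial all of whose monomials have some exponent larger than `d` has value at least
`d + 1` when the variables have value at least one. -/
lemma MvPolynomial.natCast_le_addValuation {k σ : Type*} [Field k]
    (v : AddValuation (MvPolynomial σ k) (WithTop ℝ)) (hv : ∀ f, 0 ≤ v f)
    (hX : ∀ i, 1 ≤ v (MvPolynomial.X i)) (d : ℕ) (g : MvPolynomial σ k)
    (hg : ∀ e : σ →₀ ℕ, (∀ i, e i < d) → g.coeff e = 0) : (d : WithTop ℝ) ≤ v g := by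
  rw [g.as_sum]
  refine v.map_le_sum fun e he => ?_
  have : ∃ i, d ≤ e i := by
    by_contra! h
    exact MvPolynomial.mem_support_iff.1 he (hg e h)
  obtain ⟨i, hi⟩ := this
  have hle : Finsupp.single i d ≤ e := by simpa using hi
  have : MvPolynomial.monomial e (g.coeff e) =
      MvPolynomial.X i ^ d * MvPolynomial.monomial (e - Finsupp.single i d) (g.coeff e) := by
    rw [MvPolynomial.X_pow_eq_monomial, MvPolynomial.monomial_mul, one_mul,
      add_tsub_cancel_of_le hle]
  rw [this, v.map_mul, v.map_pow]
  calc (d : WithTop ℝ) = d • (1 : WithTop ℝ) := by simp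
    _ ≤ d • v (MvPolynomial.X i) := nsmul_le_nsmul_right (hX i) d
    _ ≤ _ := le_add_of_nonneg_right (hv _)

lemma exists_succ_pow_lt_two_pow (n : ℕ) : ∃ d : ℕ, (d + 1) ^ n < 2 ^ d := by
  have h := tendsto_pow_const_div_const_pow_of_one_lt n (r := (2 : ℝ)) (by norm_num)
  have h' := (h.comp (Filter.tendsto_add_atTop_nat 1)).eventually_lt_const
    (show (0 : ℝ) < 1 / 2 by norm_num)
  obtain ⟨d, hd⟩ := h'.exists
  refine ⟨d, ?_⟩
  rw [Function.comp_apply, div_lt_iff₀ (by positivity), pow_succ 2 d] at hd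
  have : ((d + 1 : ℕ) : ℝ) ^ n < 2 ^ d := by linarith
  exact_mod_cast this

/-- The rationals `q ≥ 1` such that `2 ^ ⌊q⌋ * q` is an integer. -/
def dyadicSemigroup : AddSubsemigroup ℚ where
  carrier := {q | 1 ≤ q ∧ ∃ z : ℤ, q * 2 ^ ⌊q⌋₊ = z}
  add_mem' := by
    rintro p q ⟨hp, y, hy⟩ ⟨hq, z, hz⟩
    refine ⟨by linarith, y * 2 ^ (⌊p + q⌋₊ - ⌊p⌋₊) + z * 2 ^ (⌊p + q⌋₊ - ⌊q⌋₊), ?_⟩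
    have h1 : ⌊p⌋₊ ≤ ⌊p + q⌋₊ := Nat.floor_mono (by linarith)
    have h2 : ⌊q⌋₊ ≤ ⌊p + q⌋₊ := Nat.floor_mono (by linarith)
    push_cast
    rw [← hy, ← hz, mul_assoc, mul_assoc, ← pow_add, ← pow_add, Nat.add_sub_cancel' h1,
      Nat.add_sub_cancel' h2, add_mul]

lemma dyadicSemigroup_finite_lt (r : ℚ) :
    {u : ℚ | u ∈ dyadicSemigroup ∧ 0 ≤ u ∧ u < r}.Finite := by
  refine ((Set.finite_Icc (0 : ℤ) ⌊r * 2 ^ ⌊r⌋₊⌋).image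
    (fun z : ℤ => (z : ℚ) / 2 ^ ⌊r⌋₊)).subset ?_
  rintro u ⟨⟨-, z, hz⟩, h0, hr⟩
  have hfl : ⌊u⌋₊ ≤ ⌊r⌋₊ := Nat.floor_mono hr.le
  have heq : ((z * 2 ^ (⌊r⌋₊ - ⌊u⌋₊) : ℤ) : ℚ) = u * 2 ^ ⌊r⌋₊ := by
    push_cast
    rw [← hz, mul_assoc, ← pow_add, Nat.add_sub_cancel' hfl]
  refine ⟨z * 2 ^ (⌊r⌋₊ - ⌊u⌋₊), ⟨?_, ?_⟩, ?_⟩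
  · have : (0 : ℚ) ≤ ((z * 2 ^ (⌊r⌋₊ - ⌊u⌋₊) : ℤ) : ℚ) := by rw [heq]; positivity
    exact_mod_cast this
  · rw [Int.le_floor, heq]
    gcongr
  · dsimp only
    rw [heq, mul_div_cancel_right₀ _ (by positivity)]

lemma add_div_two_pow_mem_dyadicSemigroup {d j : ℕ} (hd : 1 ≤ d) (hj : j < 2 ^ d) :
    (d + j / 2 ^ d : ℚ) ∈ dyadicSemigroup := by
  have hd' : (1 : ℚ) ≤ d := by exact_mod_cast hd
  have hlt : (j / 2 ^ d : ℚ) < 1 := by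
    rw [div_lt_one (by positivity)]
    exact_mod_cast hj
  have h0 : (0 : ℚ) ≤ j / 2 ^ d := by positivity
  have hfl : ⌊(d + j / 2 ^ d : ℚ)⌋₊ = d := by
    rw [Nat.floor_eq_iff (by positivity)]
    constructor <;> linarith
  refine ⟨by linarith, d * 2 ^ d + j, ?_⟩
  rw [hfl]
  push_cast
  field_simp


/-- **Example 1 of the paper, rank one case.** There exists an additive
subsemigroup `U` of `ℚ` of positive elements, with `U ∩ [0, r)` finite for every rational `r`
(so `U` is well ordered of ordinal type `ω`), such that for every field `k`, every positive
integer `n`, and every real-valued (rank one) valuation `ν` on `k(x₁,…,xₙ)` dominating the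
localization of `k[x₁,…,xₙ]` at `mₙ = (x₁,…,xₙ)`, the set `{ν f : f ∈ mₙ, f ≠ 0}` is not the
image of `U` in `ℝ`. -/
theorem exists_semigroup_not_value_semigroup_of_polynomial_ring :
    ∃ U : AddSubsemigroup ℚ,
      (∀ u ∈ U, (0 : ℚ) < u) ∧
      (∀ r : ℚ, {u : ℚ | u ∈ U ∧ 0 ≤ u ∧ u < r}.Finite) ∧
      (∀ (k : Type*) (_ : Field k) (n : ℕ), 0 < n →
        ∀ ν : FractionRing (MvPolynomial (Fin n) k) → ℝ,
        (∀ x y : FractionRing (MvPolynomial (Fin n) k),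
          x ≠ 0 → y ≠ 0 → ν (x * y) = ν x + ν y) →
        (∀ x y : FractionRing (MvPolynomial (Fin n) k),
          x ≠ 0 → y ≠ 0 → x + y ≠ 0 → min (ν x) (ν y) ≤ ν (x + y)) →
        (∀ f : MvPolynomial (Fin n) k, f ≠ 0 →
          0 ≤ ν (algebraMap (MvPolynomial (Fin n) k)
                  (FractionRing (MvPolynomial (Fin n) k)) f) ∧
          (0 < ν (algebraMap (MvPolynomial (Fin n) k)
                  (FractionRing (MvPolynomial (Fin n) k)) f) ↔
            f ∈ Ideal.span (Set.range (MvPolynomial.X : Fin n → MvPolynomial (Fin n) k)))) →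
        {x : ℝ | ∃ f ∈ Ideal.span
            (Set.range (MvPolynomial.X : Fin n → MvPolynomial (Fin n) k)), f ≠ 0 ∧
            ν (algebraMap (MvPolynomial (Fin n) k)
                (FractionRing (MvPolynomial (Fin n) k)) f) = x}
          ≠ (fun q : ℚ => (q : ℝ)) '' (U : Set ℚ)) := by
  classical
  refine ⟨dyadicSemigroup, fun u hu => zero_lt_one.trans_le hu.1, dyadicSemigroup_finite_lt, ?_⟩
  intro k _ n _ ν hmul hadd hdom heq
  have hinj : ∀ f : MvPolynomial (Fin n) k, f ≠ 0 →
      algebraMap _ (FractionRing (MvPolynomial (Fin n) k)) f ≠ 0 := fun f hf => by simpa using hf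
  have hunit : ∀ f : MvPolynomial (Fin n) k, IsUnit f →
      ν (algebraMap _ (FractionRing (MvPolynomial (Fin n) k)) f) = 0 := by
    intro f hf
    obtain ⟨g, hg⟩ := hf.exists_right_inv
    have hg0 : g ≠ 0 := right_ne_zero_of_mul (hg.trans_ne one_ne_zero)
    have h1 := hmul 1 1 one_ne_zero one_ne_zero
    have h2 := hmul _ _ (hinj f hf.ne_zero) (hinj g hg0)
    rw [← map_mul, hg, map_one] at h2
    rw [mul_one] at h1
    linarith [(hdom f hf.ne_zero).1, (hdom g hg0).1]
  let v : AddValuation (MvPolynomial (Fin n) k) (WithTop ℝ) := AddValuation.of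
    (fun f => if f = 0 then ⊤ else
      ((ν (algebraMap _ (FractionRing (MvPolynomial (Fin n) k)) f) : ℝ) : WithTop ℝ))
    (by simp) (by simpa using hunit 1 isUnit_one)
    (fun f g => by
      by_cases hf : f = 0
      · simp [hf]
      by_cases hg : g = 0
      · simp [hg]
      by_cases hfg : f + g = 0
      · simp [hfg]
      simp only [hf, hg, hfg, if_false, map_add]
      exact_mod_cast hadd _ _ (hinj f hf) (hinj g hg) (by rw [← map_add]; exact hinj _ hfg))
    (fun f g => by
      by_cases hf : f = 0
      · simp [hf]
      by_cases hg : g = 0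
      · simp [hg]
      simp only [hf, hg, mul_eq_zero, or_self, if_false, map_mul]
      exact_mod_cast hmul _ _ (hinj f hf) (hinj g hg))
  have hvf : ∀ f : MvPolynomial (Fin n) k, f ≠ 0 →
      v f = (ν (algebraMap _ (FractionRing (MvPolynomial (Fin n) k)) f) : ℝ) :=
    fun f hf => if_neg hf
  have hv0 : ∀ f, 0 ≤ v f := fun f => by
    rcases eq_or_ne f 0 with rfl | hf
    · simp
    · rw [hvf f hf]
      exact_mod_cast (hdom f hf).1
  have hX : ∀ i, 1 ≤ v (MvPolynomial.X i) := fun i => by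
    obtain ⟨q, hq, hqX⟩ := heq.subset
      ⟨MvPolynomial.X i, Ideal.subset_span ⟨i, rfl⟩, MvPolynomial.X_ne_zero i, rfl⟩
    rw [hvf _ (MvPolynomial.X_ne_zero i), ← hqX]
    dsimp only
    exact_mod_cast hq.1
  obtain ⟨d, hd⟩ := exists_succ_pow_lt_two_pow n
  have hd1 : 1 ≤ d := Nat.one_le_iff_ne_zero.2 fun h => by simp [h] at hd
  have hU : ∀ j : Fin (2 ^ d), ∃ f : MvPolynomial (Fin n) k,
      v f = ((d + j / 2 ^ d : ℝ) : WithTop ℝ) := fun j => by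
    obtain ⟨f, -, hf, hfj⟩ := heq.superset
      ⟨_, add_div_two_pow_mem_dyadicSemigroup hd1 j.2, rfl⟩
    refine ⟨f, ?_⟩
    rw [hvf f hf, hfj]
    push_cast
    rfl
  choose f hf using hU
  let L : MvPolynomial (Fin n) k →ₗ[k] ((Fin n → Fin (d + 1)) → k) :=
    LinearMap.pi fun e => MvPolynomial.lcoeff k (Finsupp.equivFunOnFinite.symm fun i => (e i : ℕ))
  have hcard := card_le_finrank_of_strictMono_addValuation v
    (fun c hc => by
      have hc' : IsUnit (algebraMap k (MvPolynomial (Fin n) k) c) := hc.isUnit.map _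
      rw [hvf _ hc'.ne_zero, hunit _ hc', WithTop.coe_zero])
    L f
    (fun i j hij => by
      simp only [hf, WithTop.coe_lt_coe]
      gcongr
      exact hij)
    ((d + 1 : ℕ) : WithTop ℝ)
    (fun j => by
      have hj : (j / 2 ^ d : ℝ) < 1 := by
        rw [div_lt_one (by positivity)]
        exact_mod_cast j.2
      rw [hf, ← WithTop.coe_natCast, WithTop.coe_lt_coe]
      push_cast
      linarith)
    (fun g hg => MvPolynomial.natCast_le_addValuation v hv0 hX (d + 1) g fun e he => by
      have := congrFun hg fun i => ⟨e i, he i⟩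
      have he' : (Finsupp.equivFunOnFinite.symm fun i => e i) = e := by ext; simp
      simpa [L, he'] using this)
  rw [Module.finrank_fintype_fun_eq_card, Fintype.card_fun, Fintype.card_fin, Fintype.card_fin]
    at hcard
  exact absurd hcard hd.not_ge
end

section
/- Let k be a field, n a positive integer, R = k[[x₁,…,xₙ]] the formal power series ring with maximal ideal m_R, and let ν be a real-valued (rank one) valuation on the fraction field of R dominating R. Then for every nonzero f ∈ m_R there exists a nonzero polynomial g ∈ k[x₁,…,xₙ] with zero constant term such that ν(g) = ν(f). Consequently ν(m_R ∖ {0}) equals the set of values ν(g) over nonzero polynomials g with zero constant term. -/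
/-- A formal power series ring over a field is an integral domain. -/
instance mvPowerSeries_isDomain {k : Type*} [Field k] {n : ℕ} :
    IsDomain (MvPowerSeries (Fin n) k) :=
  NoZeroDivisors.to_isDomain _

namespace MvPowerSeries

/-- A power series in finitely many variables all of whose exponents have some component at least
`N` is a sum of multiples of the pure powers `X i ^ N`. -/
theorem exists_eq_sum_X_pow_dvd {σ A : Type*} [Fintype σ] [CommSemiring A] (N : ℕ)
    (h : MvPowerSeries σ A) (hh : ∀ m : σ →₀ ℕ, (∀ i, m i < N) → coeff m h = 0) :
    ∃ p : σ → MvPowerSeries σ A, (∀ i, X i ^ N ∣ p i) ∧ h = ∑ i, p i := by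
  classical
  have hc : ∀ m : σ →₀ ℕ, ∃ o : Option σ,
      (∀ i, o = some i → N ≤ m i) ∧ (o = none → coeff m h = 0) := by
    intro m
    by_cases hm : ∃ i, N ≤ m i
    · obtain ⟨i, hi⟩ := hm
      exact ⟨some i, by simpa using hi, by simp⟩
    · push Not at hm
      exact ⟨none, by simp, fun _ => hh m hm⟩
  choose c hc₁ hc₂ using hc
  let p : σ → MvPowerSeries σ A := fun i m => if c m = some i then coeff m h else 0
  have hp : ∀ i m, coeff m (p i) = if c m = some i then coeff m h else 0 := fun _ _ => rfl
  refine ⟨p, fun i => X_pow_dvd_iff.2 fun m hm => ?_, ?_⟩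
  · rw [hp, if_neg fun hcm => (hc₁ m i hcm).not_gt hm]
  · ext m
    rw [map_sum]
    simp only [hp]
    cases hcm : c m with
    | none => simp [hc₂ m hcm]
    | some j => simp

theorem mem_maximalIdeal_iff_constantCoeff_eq_zero {σ k : Type*} [Field k]
    {φ : MvPowerSeries σ k} :
    φ ∈ IsLocalRing.maximalIdeal (MvPowerSeries σ k) ↔ constantCoeff φ = 0 := by
  rw [IsLocalRing.mem_maximalIdeal, mem_nonunits_iff, isUnit_iff_constantCoeff,
    isUnit_iff_ne_zero, not_not]

end MvPowerSeries

section RealValuation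

variable {F : Type*} [Field F] {ν : F → ℝ}

theorem realValuation_one (hmul : ∀ x y : F, x ≠ 0 → y ≠ 0 → ν (x * y) = ν x + ν y) :
    ν 1 = 0 := by
  have h := hmul 1 1 one_ne_zero one_ne_zero
  rw [mul_one] at h
  linarith

theorem realValuation_neg (hmul : ∀ x y : F, x ≠ 0 → y ≠ 0 → ν (x * y) = ν x + ν y)
    {x : F} (hx : x ≠ 0) : ν (-x) = ν x := by
  have h₁ : (-1 : F) ≠ 0 := neg_ne_zero.2 one_ne_zero
  have h := hmul (-1) (-1) h₁ h₁
  rw [neg_mul_neg, mul_one, realValuation_one hmul] at h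
  rw [← neg_one_mul, hmul _ _ h₁ hx]
  linarith

theorem realValuation_pow (hmul : ∀ x y : F, x ≠ 0 → y ≠ 0 → ν (x * y) = ν x + ν y)
    {x : F} (hx : x ≠ 0) (N : ℕ) : ν (x ^ N) = N * ν x := by
  induction N with
  | zero => simp [realValuation_one hmul]
  | succ N ih =>
    rw [pow_succ, hmul _ _ (pow_ne_zero _ hx) hx, ih]
    push_cast
    ring

theorem lt_realValuation_sum
    (hadd : ∀ x y : F, x ≠ 0 → y ≠ 0 → x + y ≠ 0 → min (ν x) (ν y) ≤ ν (x + y))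
    {ι : Type*} (s : Finset ι) (u : ι → F) (c : ℝ) (hu : ∀ i ∈ s, u i ≠ 0 → c < ν (u i))
    (hs : ∑ i ∈ s, u i ≠ 0) : c < ν (∑ i ∈ s, u i) := by
  classical
  induction s using Finset.induction_on with
  | empty => simp at hs
  | insert a s ha ih =>
    rw [Finset.sum_insert ha] at hs ⊢
    have hus : ∀ i ∈ s, u i ≠ 0 → c < ν (u i) :=
      fun i hi => hu i (Finset.mem_insert_of_mem hi)
    by_cases h₁ : u a = 0
    · rw [h₁, zero_add] at hs ⊢
      exact ih hus hs
    have h₂ := hu a (Finset.mem_insert_self a s) h₁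
    by_cases h₃ : ∑ i ∈ s, u i = 0
    · rwa [h₃, add_zero]
    exact (lt_min h₂ (ih hus h₃)).trans_le (hadd _ _ h₁ h₃ hs)

/-- Two elements whose difference has larger value than the first have the same value. -/
theorem realValuation_eq_of_sub
    (hmul : ∀ x y : F, x ≠ 0 → y ≠ 0 → ν (x * y) = ν x + ν y)
    (hadd : ∀ x y : F, x ≠ 0 → y ≠ 0 → x + y ≠ 0 → min (ν x) (ν y) ≤ ν (x + y))
    {x y : F} (hx : x ≠ 0) (hxy : x - y ≠ 0 → ν x < ν (x - y)) : y ≠ 0 ∧ ν y = ν x := by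
  by_cases h₀ : x - y = 0
  · rw [← sub_eq_zero.1 h₀]
    exact ⟨hx, rfl⟩
  have hlt := hxy h₀
  have hy : y ≠ 0 := by
    rintro rfl
    simp at hlt
  refine ⟨hy, le_antisymm ?_ ?_⟩
  · have h := hadd y (x - y) hy h₀ (by simpa using hx)
    rw [add_sub_cancel] at h
    rcases min_le_iff.1 h with h | h
    · exact h
    · exact absurd h hlt.not_ge
  · have h := hadd x (-(x - y)) hx (neg_ne_zero.2 h₀) (by simpa using hy)
    rw [realValuation_neg hmul h₀, min_eq_left hlt.le] at h
    simpa using h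

end RealValuation

/-- **key approximation step in Theorem 1 of the paper.** Let `k` be a field,
`n` a positive integer, `R = k[[x₁,…,xₙ]]` with maximal ideal `m_R`, and let `ν` be a
real-valued (rank one) valuation on the fraction field of `R` dominating `R`.  Then for every
nonzero `f ∈ m_R` there is a nonzero polynomial `g ∈ k[x₁,…,xₙ]` with zero constant term and
`ν g = ν f`; consequently `ν(m_R ∖ {0})` equals the set of values of `ν` on nonzero polynomials
with zero constant term. -/
theorem exists_polynomial_with_same_value_power_series
    {k : Type*} [Field k] (n : ℕ) (hn : 0 < n)
    (ν : FractionRing (MvPowerSeries (Fin n) k) → ℝ)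
    (hmul : ∀ x y : FractionRing (MvPowerSeries (Fin n) k),
      x ≠ 0 → y ≠ 0 → ν (x * y) = ν x + ν y)
    (hadd : ∀ x y : FractionRing (MvPowerSeries (Fin n) k),
      x ≠ 0 → y ≠ 0 → x + y ≠ 0 → min (ν x) (ν y) ≤ ν (x + y))
    (hdom : ∀ a : MvPowerSeries (Fin n) k, a ≠ 0 →
      0 ≤ ν (algebraMap (MvPowerSeries (Fin n) k)
              (FractionRing (MvPowerSeries (Fin n) k)) a) ∧
      (0 < ν (algebraMap (MvPowerSeries (Fin n) k)
              (FractionRing (MvPowerSeries (Fin n) k)) a) ↔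
        a ∈ IsLocalRing.maximalIdeal (MvPowerSeries (Fin n) k))) :
    (∀ f ∈ IsLocalRing.maximalIdeal (MvPowerSeries (Fin n) k), f ≠ 0 →
      ∃ g : MvPolynomial (Fin n) k, g ≠ 0 ∧ MvPolynomial.coeff 0 g = 0 ∧
        ν (algebraMap (MvPowerSeries (Fin n) k) (FractionRing (MvPowerSeries (Fin n) k))
            (algebraMap (MvPolynomial (Fin n) k) (MvPowerSeries (Fin n) k) g)) =
        ν (algebraMap (MvPowerSeries (Fin n) k) (FractionRing (MvPowerSeries (Fin n) k)) f)) ∧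
    {x : ℝ | ∃ f ∈ IsLocalRing.maximalIdeal (MvPowerSeries (Fin n) k), f ≠ 0 ∧
        ν (algebraMap (MvPowerSeries (Fin n) k)
            (FractionRing (MvPowerSeries (Fin n) k)) f) = x}
      = {x : ℝ | ∃ g : MvPolynomial (Fin n) k, g ≠ 0 ∧ MvPolynomial.coeff 0 g = 0 ∧
          ν (algebraMap (MvPowerSeries (Fin n) k) (FractionRing (MvPowerSeries (Fin n) k))
              (algebraMap (MvPolynomial (Fin n) k) (MvPowerSeries (Fin n) k) g)) = x} := by
  have hinj := IsFractionRing.injective (MvPowerSeries (Fin n) k)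
    (FractionRing (MvPowerSeries (Fin n) k))
  have hne : ∀ a : MvPowerSeries (Fin n) k, a ≠ 0 →
      algebraMap (MvPowerSeries (Fin n) k) (FractionRing (MvPowerSeries (Fin n) k)) a ≠ 0 :=
    fun a ha => (map_ne_zero_iff _ hinj).2 ha
  have hcoe : ∀ g : MvPolynomial (Fin n) k,
      algebraMap (MvPolynomial (Fin n) k) (MvPowerSeries (Fin n) k) g =
        (g : MvPowerSeries (Fin n) k) := fun _ => rfl
  have key : ∀ f ∈ IsLocalRing.maximalIdeal (MvPowerSeries (Fin n) k), f ≠ 0 →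
      ∃ g : MvPolynomial (Fin n) k, g ≠ 0 ∧ MvPolynomial.coeff 0 g = 0 ∧
        ν (algebraMap (MvPowerSeries (Fin n) k) (FractionRing (MvPowerSeries (Fin n) k))
            (algebraMap (MvPolynomial (Fin n) k) (MvPowerSeries (Fin n) k) g)) =
        ν (algebraMap (MvPowerSeries (Fin n) k)
            (FractionRing (MvPowerSeries (Fin n) k)) f) := by
    intro f hf hf0
    set φ := algebraMap (MvPowerSeries (Fin n) k) (FractionRing (MvPowerSeries (Fin n) k))
    have hX0 : ∀ i : Fin n, (MvPowerSeries.X i : MvPowerSeries (Fin n) k) ≠ 0 := by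
      intro i h
      simpa using congrArg (MvPowerSeries.coeff (Finsupp.single i 1)) h
    have hX : ∀ i : Fin n, 0 < ν (φ (MvPowerSeries.X i)) := fun i =>
      (hdom _ (hX0 i)).2.2
        (MvPowerSeries.mem_maximalIdeal_iff_constantCoeff_eq_zero.2 (by simp))
    have hN : ∃ N : ℕ, ∀ i : Fin n, ν (φ f) < N * ν (φ (MvPowerSeries.X i)) := by
      choose M hM using fun i : Fin n => exists_nat_gt (ν (φ f) / ν (φ (MvPowerSeries.X i)))
      refine ⟨∑ i, M i, fun i => ?_⟩
      rw [← div_lt_iff₀ (hX i)]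
      refine (hM i).trans_le ?_
      exact_mod_cast Finset.single_le_sum (fun _ _ => Nat.zero_le _) (Finset.mem_univ i)
    obtain ⟨N, hN⟩ := hN
    let g : MvPolynomial (Fin n) k :=
      MvPowerSeries.trunc' k (Finsupp.equivFunOnFinite.symm fun _ => N) f
    have hg : ∀ m : Fin n →₀ ℕ, (∀ i, m i ≤ N) →
        MvPolynomial.coeff m g = MvPowerSeries.coeff m f := fun m hm => by
      rw [MvPowerSeries.coeff_trunc', if_pos]
      exact fun i => hm i
    obtain ⟨p, hp, hsum⟩ := MvPowerSeries.exists_eq_sum_X_pow_dvd N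
      (f - (g : MvPowerSeries (Fin n) k)) fun m hm => by
        rw [map_sub, MvPolynomial.coeff_coe, hg m fun i => (hm i).le, sub_self]
    have hlt : φ f - φ g ≠ 0 → ν (φ f) < ν (φ f - φ g) := by
      rw [← map_sub, hsum, map_sum]
      refine lt_realValuation_sum hadd _ _ _ fun i _ hi => ?_
      obtain ⟨q, hq⟩ := hp i
      rw [hq, map_mul, map_pow] at hi ⊢
      have hq0 : q ≠ 0 := by
        rintro rfl
        simp at hi
      rw [hmul _ _ (left_ne_zero_of_mul hi) (right_ne_zero_of_mul hi),
        realValuation_pow hmul (hne _ (hX0 i))]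
      have := (hdom q hq0).1
      linarith [hN i]
    obtain ⟨h0, hν⟩ := realValuation_eq_of_sub hmul hadd (hne f hf0) hlt
    refine ⟨g, ?_, ?_, hν⟩
    · intro hg0
      simp [hg0] at h0
    · rw [hg 0 (by simp), MvPowerSeries.coeff_zero_eq_constantCoeff_apply]
      exact MvPowerSeries.mem_maximalIdeal_iff_constantCoeff_eq_zero.1 hf
  refine ⟨key, Set.ext fun x => ⟨?_, ?_⟩⟩
  · rintro ⟨f, hf, hf0, rfl⟩
    exact key f hf hf0
  · rintro ⟨g, hg0, hgc, rfl⟩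
    refine ⟨_, MvPowerSeries.mem_maximalIdeal_iff_constantCoeff_eq_zero.2 ?_, ?_, rfl⟩
    · rw [hcoe, ← MvPowerSeries.coeff_zero_eq_constantCoeff_apply, MvPolynomial.coeff_coe, hgc]
    · rw [hcoe, Ne, MvPolynomial.coe_eq_zero_iff]
      exact hg0
end
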